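/- Define a sequence of functions f_k : ℂ → ℂ recursively by f_1(x) = x/(1-x)^2 and f_{k+1}(x) = x · f_k'(x) (where f_k' denotes the complex derivative of f_k). Then for every integer k ≥ 1 and every x ∈ ℂ with x ≠ 0 and x ≠ 1, one has f_k(x⁻¹) = (-1)^{k+1} f_k(x). -/

import Mathlib

open Complex

/-- The sequence of rational functions from Lemma 4.1:
`f 1 x = x / (1 - x)^2` and `f (k+1) x = x * (f k)'(x)`.
(The value at index `0` is irrelevant and set to `0`.) -/
noncomputable def flopF : ℕ → ℂ → ℂ
  | 0 => fun _ => 0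
  | 1 => fun x => x / (1 - x) ^ 2
  | (k + 2) => fun x => x * deriv (flopF (k + 1)) x

theorem differentiableOn_flopF (k : ℕ) : DifferentiableOn ℂ (flopF k) {1}ᶜ := by
  induction k using flopF.induct with
  | case1 => simpa only [flopF] using differentiableOn_const 0
  | case2 =>
    simp only [flopF]
    refine differentiableOn_id.div (by fun_prop) fun x hx => ?_
    exact pow_ne_zero _ (sub_ne_zero.mpr (Ne.symm hx))
  | case3 k ih =>
    simp only [flopF]
    exact differentiableOn_id.mul (ih.deriv isOpen_compl_singleton)

theorem differentiableAt_flopF (k : ℕ) {x : ℂ} (hx : x ≠ 1) :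
    DifferentiableAt ℂ (flopF k) x :=
  (differentiableOn_flopF k).differentiableAt (isOpen_compl_singleton.mem_nhds hx)

/-- Functional equation of Lemma 4.1: `f_k(x⁻¹) = (-1)^(k+1) f_k(x)` for all
`k ≥ 1` and `x ∈ ℂ \ {0, 1}`. -/
theorem flopF_inv (k : ℕ) (hk : 1 ≤ k) (x : ℂ) (hx0 : x ≠ 0) (hx1 : x ≠ 1) :
    flopF k x⁻¹ = (-1) ^ (k + 1) * flopF k x := by
  induction k, hk using Nat.le_induction generalizing x with
  | base =>
    have h : 1 - x ≠ 0 := sub_ne_zero.mpr hx1.symm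
    have h' : x - 1 ≠ 0 := sub_ne_zero.mpr hx1
    have hinv : 1 - x⁻¹ = (x - 1) / x := by field_simp
    simp only [flopF, hinv]
    field_simp
    ring
  | succ k hk ih =>
    obtain ⟨k, rfl⟩ := Nat.exists_eq_add_of_le' hk
    have hev : (fun y => flopF (k + 1) y⁻¹) =ᶠ[nhds x]
        fun y => (-1) ^ (k + 1 + 1) * flopF (k + 1) y := by
      filter_upwards [isOpen_ne.mem_nhds hx0, isOpen_ne.mem_nhds hx1] with y hy0 hy1
      exact ih y hy0 hy1
    have hcomp : HasDerivAt (fun y => flopF (k + 1) y⁻¹)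
        (deriv (flopF (k + 1)) x⁻¹ * -(x ^ 2)⁻¹) x :=
      (differentiableAt_flopF (k + 1) (inv_ne_one.mpr hx1)).hasDerivAt.comp x (hasDerivAt_inv hx0)
    have hmul := (differentiableAt_flopF (k + 1) hx1).hasDerivAt.const_mul
      ((-1 : ℂ) ^ (k + 1 + 1))
    have hderiv := hcomp.unique (hmul.congr_of_eventuallyEq hev)
    simp only [flopF]
    calc x⁻¹ * deriv (flopF (k + 1)) x⁻¹
        = -x * (deriv (flopF (k + 1)) x⁻¹ * -(x ^ 2)⁻¹) := by field_simp
      _ = (-1) ^ (k + 1 + 1 + 1) * (x * deriv (flopF (k + 1)) x) := by rw [hderiv]; ring
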